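/- For every dimension d ≥ 1 and every chemical potential μ with 0 < μ < 4d, there exist a finite length L_#(μ) and a finite coupling constant U_#(μ) ≥ 0 such that for every even integer L ≥ L_#(μ) and every U ≥ U_#(μ), the HFz ground-state energy equals the sum of the negative eigenvalues of -Δ - μ·Id, i.e. E^{hfz}_{μ,U} = Tr{[-Δ - μ·Id]_-}. -/

import Mathlib

open Matrix
open scoped BigOperators Classical ComplexOrder

noncomputable section

/-- The discrete torus `Λ = (ℤ/Lℤ)^d`. -/
abbrev Lam (d L : ℕ) : Type := Fin d → ZMod L

/-- `x` and `y` are nearest neighbors on the torus (ℓ¹-distance 1). -/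
def isNN {d L : ℕ} (x y : Lam d L) : Prop :=
  ∃ ν : Fin d, (x ν = y ν + 1 ∨ x ν + 1 = y ν) ∧ ∀ μ : Fin d, μ ≠ ν → x μ = y μ

/-- The discrete Laplacian `Δ = T - 2d·Id` on the torus. -/
def lap (d L : ℕ) : Matrix (Lam d L) (Lam d L) ℂ :=
  (Matrix.of fun x y => if isNN x y then (1 : ℂ) else 0) - (2 * (d : ℂ)) • 1

/-- A one-particle density matrix: hermitian with `0 ≤ γ ≤ 1` as quadratic forms. -/
def IsDM {d L : ℕ} [NeZero L] (γ : Matrix (Lam d L) (Lam d L) ℂ) : Prop :=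
  γ.PosSemidef ∧ (1 - γ).PosSemidef

/-- `Tr{[X]_-}`: the sum of the negative eigenvalues of a hermitian matrix `X`
(junk value `0` if `X` is not hermitian). -/
def negTrace {n : Type} [Fintype n] [DecidableEq n] (X : Matrix n n ℂ) : ℝ :=
  if hX : X.IsHermitian then ∑ i, min (hX.eigenvalues i) 0 else 0

/-- The HFz energy functional. -/
def hfzE {d L : ℕ} [NeZero L] (μ U : ℝ) (γu γd : Matrix (Lam d L) (Lam d L) ℂ) : ℝ :=
  (((-(lap d L) - (μ : ℂ) • 1) * (γu + γd)).trace).re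
    + U * ∑ x, (γu x x).re * (γd x x).re

/-- The set of HFz energy values over pairs of one-particle density matrices. -/
def hfzEnergies (d L : ℕ) [NeZero L] (μ U : ℝ) : Set ℝ :=
  { E | ∃ γu γd : Matrix (Lam d L) (Lam d L) ℂ, IsDM γu ∧ IsDM γd ∧ hfzE μ U γu γd = E }

theorem posSemidef_sub_sq {n : Type} [Fintype n] [DecidableEq n] {G : Matrix n n ℂ}
    (h0 : G.PosSemidef) (h1 : (1 - G).PosSemidef) : (G - G * G).PosSemidef := by
  have h2 := h1.mul_mul_conjTranspose_same G
  have h3 := h0.mul_mul_conjTranspose_same (1 - G)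
  have h4 := h2.add h3
  rw [h0.1.eq, h1.1.eq] at h4
  convert h4 using 1
  noncomm_ring

theorem sum_sq_row_le {n : Type} [Fintype n] [DecidableEq n] {G : Matrix n n ℂ}
    (h0 : G.PosSemidef) (h1 : (1 - G).PosSemidef) (k : n) :
    ∑ l, ‖G k l‖ ^ 2 ≤ (G k k).re := by
  have h := (posSemidef_sub_sq h0 h1).diag_nonneg (i := k)
  rw [Complex.le_def] at h
  have h' := h.1
  simp only [Matrix.sub_apply, Matrix.mul_apply, Complex.sub_re, Complex.re_sum,
    Complex.zero_re] at h'
  have : ∀ l, (G k l * G l k).re = ‖G k l‖ ^ 2 := fun l => by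
    rw [← h0.1.apply l k, Complex.star_def, Complex.mul_conj, Complex.normSq_eq_norm_sq,
      Complex.ofReal_re]
  simp only [this] at h'
  linarith

theorem diag_re_nonneg {n : Type} [Fintype n] {G : Matrix n n ℂ}
    (h0 : G.PosSemidef) (k : n) : 0 ≤ (G k k).re := by
  have h := h0.diag_nonneg (i := k)
  rw [Complex.le_def] at h
  simpa using h.1

theorem diag_re_le_one {n : Type} [Fintype n] [DecidableEq n] {G : Matrix n n ℂ}
    (h1 : (1 - G).PosSemidef) (k : n) : (G k k).re ≤ 1 := by
  have h := diag_re_nonneg h1 k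
  simp at h
  exact h

theorem norm_sq_apply_le {n : Type} [Fintype n] {G : Matrix n n ℂ}
    (h0 : G.PosSemidef) (x y : n) : ‖G x y‖ ^ 2 ≤ (G x x).re * (G y y).re := by
  have h := (h0.submatrix ![x, y]).det_nonneg
  rw [Matrix.det_fin_two, Complex.le_def] at h
  have h' := h.1
  have e1 : (G x x).im = 0 := Complex.conj_eq_iff_im.1 (h0.1.apply x x)
  simp only [Matrix.submatrix_apply, Matrix.cons_val_zero, Matrix.cons_val_one] at h'
  rw [← h0.1.apply y x, Complex.star_def, Complex.mul_conj, Complex.normSq_eq_norm_sq] at h'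
  simp [e1, -Complex.ofReal_pow] at h'
  exact h'

theorem sum_norm_sq_eq_trace {n : Type} [Fintype n] (A : Matrix n n ℂ) :
    ∑ x, ∑ y, ‖A x y‖ ^ 2 = (A * Aᴴ).trace.re := by
  rw [Matrix.trace, Complex.re_sum]
  refine Finset.sum_congr rfl fun x _ => ?_
  rw [Matrix.diag_apply, Matrix.mul_apply, Complex.re_sum]
  refine Finset.sum_congr rfl fun y _ => ?_
  rw [Matrix.conjTranspose_apply, Complex.star_def, Complex.mul_conj, Complex.normSq_eq_norm_sq,
    Complex.ofReal_re]

/-- The matrix `W diag(f) Wᴴ`. -/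
def specM {n : Type} [Fintype n] [DecidableEq n] (W : Matrix n n ℂ) (f : n → ℝ) :
    Matrix n n ℂ := W * diagonal (fun k => (f k : ℂ)) * Wᴴ

section
variable {n : Type} [Fintype n] [DecidableEq n]

theorem specM_posSemidef (W : Matrix n n ℂ) {f : n → ℝ} (hf : ∀ k, 0 ≤ f k) :
    (specM W f).PosSemidef := by
  refine Matrix.PosSemidef.mul_mul_conjTranspose_same ?_ W
  rw [Matrix.posSemidef_diagonal_iff]
  intro k
  exact_mod_cast hf k

theorem one_sub_specM {W : Matrix n n ℂ} (hW : W * Wᴴ = 1) (f : n → ℝ) :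
    1 - specM W f = specM W (fun k => 1 - f k) := by
  have : (diagonal fun k => (((1 - f k : ℝ)) : ℂ)) = 1 - diagonal fun k => (f k : ℂ) := by
    rw [← Matrix.diagonal_one, Matrix.diagonal_sub]
    simp
  rw [specM, specM, this, Matrix.mul_sub, Matrix.sub_mul, Matrix.mul_one, hW]

theorem one_sub_specM_posSemidef {W : Matrix n n ℂ} (hW : W * Wᴴ = 1) {f : n → ℝ}
    (hf : ∀ k, f k ≤ 1) : (1 - specM W f).PosSemidef := by
  rw [one_sub_specM hW]
  exact specM_posSemidef W fun k => sub_nonneg.2 (hf k)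

theorem trace_specM_mul (W : Matrix n n ℂ) (e : n → ℝ) (γ : Matrix n n ℂ) :
    (specM W e * γ).trace.re = ∑ k, e k * ((Wᴴ * γ * W) k k).re := by
  have : (specM W e * γ).trace = (diagonal (fun k => (e k : ℂ)) * (Wᴴ * γ * W)).trace := by
    rw [specM, Matrix.mul_assoc, Matrix.mul_assoc, Matrix.trace_mul_comm]
    simp only [Matrix.mul_assoc]
  rw [this, Matrix.trace, Complex.re_sum]
  simp [Matrix.diagonal_mul]

theorem sum_norm_sq_conj {W : Matrix n n ℂ} (hW : W * Wᴴ = 1) (B : Matrix n n ℂ) :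
    ∑ x, ∑ y, ‖(W * B * Wᴴ) x y‖ ^ 2 = ∑ x, ∑ y, ‖B x y‖ ^ 2 := by
  have hW' : Wᴴ * W = 1 := mul_eq_one_comm.1 hW
  rw [sum_norm_sq_eq_trace, sum_norm_sq_eq_trace]
  congr 1
  have : W * B * Wᴴ * (W * B * Wᴴ)ᴴ = W * (B * Bᴴ * Wᴴ) := by
    simp only [Matrix.conjTranspose_mul, Matrix.conjTranspose_conjTranspose]
    calc _ = W * B * (Wᴴ * W) * (Bᴴ * Wᴴ) := by simp only [Matrix.mul_assoc]
      _ = _ := by rw [hW']; simp only [Matrix.mul_assoc, Matrix.mul_one]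
  rw [this, Matrix.trace_mul_comm, Matrix.mul_assoc, hW', Matrix.mul_one]

/-- The excess energy of a density matrix over the Fermi sea controls the Hilbert–Schmidt distance
of the two, away from the Fermi surface. -/
theorem excess_energy_bound {W : Matrix n n ℂ} (hW : W * Wᴴ = 1) (e : n → ℝ) {γ : Matrix n n ℂ}
    (h0 : γ.PosSemidef) (h1 : (1 - γ).PosSemidef) {ε : ℝ} {ν : ℝ}
    (hν : ∀ x, (specM W (fun k => if |e k| < ε then 1 else 0) x x).re ≤ ν) :
    ∃ Y : Matrix n n ℂ,
      (∀ x y, ‖specM W (fun k => if e k < 0 then 1 else 0) x y - γ x y‖ ≤ ‖Y x y‖ + 2 * √ν) ∧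
      ε * ∑ x, ∑ y, ‖Y x y‖ ^ 2 ≤ (specM W e * γ).trace.re - ∑ k, min (e k) 0 := by
  have hW' : Wᴴ * W = 1 := mul_eq_one_comm.1 hW
  set f : n → ℝ := fun k => if e k < 0 then 1 else 0 with hf
  set q : n → ℝ := fun k => if |e k| < ε then 1 else 0 with hq
  set P := specM W f with hP
  set Q := specM W q with hQ
  set G := Wᴴ * γ * W with hG
  have hf01 : ∀ k, 0 ≤ f k ∧ f k ≤ 1 := fun k => by simp only [hf]; split_ifs <;> norm_num
  have hq01 : ∀ k, 0 ≤ q k ∧ q k ≤ 1 := fun k => by simp only [hq]; split_ifs <;> norm_num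
  have P0 : P.PosSemidef := specM_posSemidef W fun k => (hf01 k).1
  have P1 : (1 - P).PosSemidef := one_sub_specM_posSemidef hW fun k => (hf01 k).2
  have Q0 : Q.PosSemidef := specM_posSemidef W fun k => (hq01 k).1
  have Q1 : (1 - Q).PosSemidef := one_sub_specM_posSemidef hW fun k => (hq01 k).2
  have G0 : G.PosSemidef := h0.conjTranspose_mul_mul_same W
  have G1 : (1 - G).PosSemidef := by
    have := h1.conjTranspose_mul_mul_same W
    rwa [Matrix.mul_sub, Matrix.sub_mul, Matrix.mul_one, hW'] at this
  refine ⟨(1 - Q) * (P - γ), fun x y => ?_, ?_⟩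
  · have hZ : ‖(Q * (P - γ)) x y‖ ≤ 2 * √ν := by
      have hcs : ‖(Q * (P - γ)) x y‖ ^ 2 ≤ (∑ z, ‖Q x z‖ ^ 2) * ∑ z, ‖(P - γ) z y‖ ^ 2 := by
        have h2 : ‖(Q * (P - γ)) x y‖ ≤ ∑ z, ‖Q x z‖ * ‖(P - γ) z y‖ := by
          rw [Matrix.mul_apply]
          refine (norm_sum_le _ _).trans_eq ?_
          simp only [norm_mul]
        exact (pow_le_pow_left₀ (norm_nonneg _) h2 2).trans
          (Finset.sum_mul_sq_le_sq_mul_sq _ _ _)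
      have hQx : ∑ z, ‖Q x z‖ ^ 2 ≤ ν := (sum_sq_row_le Q0 Q1 x).trans (hν x)
      have hcol : ∀ {B : Matrix n n ℂ}, B.PosSemidef → (1 - B).PosSemidef →
          ∑ z, ‖B z y‖ ^ 2 ≤ 1 := fun {B} b0 b1 => by
        refine le_trans (le_of_eq ?_) ((sum_sq_row_le b0 b1 y).trans (diag_re_le_one b1 y))
        refine Finset.sum_congr rfl fun z _ => ?_
        rw [← b0.1.apply z y, norm_star]
      have hX : ∑ z, ‖(P - γ) z y‖ ^ 2 ≤ 4 := by
        have : ∀ z, ‖(P - γ) z y‖ ^ 2 ≤ 2 * ‖P z y‖ ^ 2 + 2 * ‖γ z y‖ ^ 2 := fun z => by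
          have := norm_sub_le (P z y) (γ z y)
          rw [Matrix.sub_apply]
          nlinarith [norm_nonneg (P z y - γ z y), sq_nonneg (‖P z y‖ - ‖γ z y‖)]
        have h3 := Finset.sum_le_sum fun z (_ : z ∈ Finset.univ) => this z
        rw [Finset.sum_add_distrib, ← Finset.mul_sum, ← Finset.mul_sum] at h3
        linarith [hcol P0 P1, hcol h0 h1]
      have hν0 : 0 ≤ ν := (diag_re_nonneg Q0 x).trans (hν x)
      have h4 : ‖(Q * (P - γ)) x y‖ ^ 2 ≤ (2 * √ν) ^ 2 := by
        rw [mul_pow, Real.sq_sqrt hν0]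
        have : 0 ≤ ∑ z, ‖(P - γ) z y‖ ^ 2 := Finset.sum_nonneg fun z _ => sq_nonneg _
        nlinarith
      exact (abs_le_of_sq_le_sq' h4 (by positivity)).2
    have : P x y - γ x y = ((1 - Q) * (P - γ)) x y + (Q * (P - γ)) x y := by
      rw [← Matrix.add_apply, ← Matrix.add_mul, sub_add_cancel, Matrix.one_mul, Matrix.sub_apply]
    rw [this]
    exact (norm_add_le _ _).trans (by linarith)
  · have hY : (1 - Q) * (P - γ) = W * (diagonal (fun k => ((1 - q k : ℝ) : ℂ)) *
        (diagonal (fun k => (f k : ℂ)) - G)) * Wᴴ := by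
      rw [hQ, one_sub_specM hW]
      have : P - γ = W * (diagonal (fun k => (f k : ℂ)) - G) * Wᴴ := by
        rw [Matrix.mul_sub, Matrix.sub_mul, hP, specM, hG]
        congr 1
        calc γ = (W * Wᴴ) * γ * (W * Wᴴ) := by rw [hW]; simp
          _ = _ := by simp only [Matrix.mul_assoc]
      rw [this, specM]
      calc _ = W * diagonal (fun k => ((1 - q k : ℝ) : ℂ)) * (Wᴴ * W) *
            ((diagonal (fun k => (f k : ℂ)) - G) * Wᴴ) := by simp only [Matrix.mul_assoc]
        _ = _ := by rw [hW']; simp only [Matrix.mul_assoc, Matrix.mul_one]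
    rw [hY, sum_norm_sq_conj hW, trace_specM_mul, Finset.mul_sum, ← Finset.sum_sub_distrib]
    refine Finset.sum_le_sum fun k _ => ?_
    rw [← hG]
    have g0 := diag_re_nonneg G0 k
    have g1 := diag_re_le_one G1 k
    have r0 := sum_sq_row_le G0 G1 k
    have r1 := sum_sq_row_le G1 (by simpa using G0) k
    simp only [Matrix.diagonal_mul, Matrix.sub_apply, norm_mul, mul_pow]
    by_cases hk : |e k| < ε
    · have : q k = 1 := if_pos hk
      simp only [this, sub_self, Complex.ofReal_zero, norm_zero]
      simp only [ne_eq, OfNat.ofNat_ne_zero, not_false_eq_true, zero_pow, zero_mul,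
        Finset.sum_const_zero, mul_zero]
      rcases le_or_gt 0 (e k) with h | h
      · rw [min_eq_right h]; nlinarith
      · rw [min_eq_left h.le]; nlinarith
    · have : q k = 0 := if_neg hk
      simp only [this, sub_zero, Complex.ofReal_one, norm_one, one_pow, one_mul]
      rw [not_lt] at hk
      rcases le_or_gt 0 (e k) with h | h
      · have hfk : f k = 0 := if_neg (not_lt.2 h)
        rw [abs_of_nonneg h] at hk
        have : ∀ l, ‖diagonal (fun k => (f k : ℂ)) k l - G k l‖ ^ 2 = ‖G k l‖ ^ 2 := fun l => by
          rw [Matrix.diagonal_apply]; simp [hfk]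
        simp only [this]
        rw [min_eq_right h]
        have : 0 ≤ ∑ l, ‖G k l‖ ^ 2 := Finset.sum_nonneg fun z _ => sq_nonneg _
        nlinarith
      · have hfk : f k = 1 := if_pos h
        rw [abs_of_neg h] at hk
        have : ∀ l, ‖diagonal (fun k => (f k : ℂ)) k l - G k l‖ ^ 2 = ‖(1 - G) k l‖ ^ 2 :=
          fun l => by
            rw [Matrix.diagonal_apply, Matrix.sub_apply, Matrix.one_apply]; simp [hfk]
        simp only [this]
        rw [min_eq_left h.le]
        have h5 : 0 ≤ ∑ l, ‖(1 - G) k l‖ ^ 2 := Finset.sum_nonneg fun z _ => sq_nonneg _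
        simp only [Matrix.sub_apply, Matrix.one_apply_eq, Complex.sub_re, Complex.one_re] at r1 h5 ⊢
        nlinarith

theorem trace_specM_fermi {W : Matrix n n ℂ} (hW : W * Wᴴ = 1) (e : n → ℝ) :
    (specM W e * specM W (fun k => if e k < 0 then 1 else 0)).trace.re = ∑ k, min (e k) 0 := by
  have hW' : Wᴴ * W = 1 := mul_eq_one_comm.1 hW
  rw [trace_specM_mul]
  refine Finset.sum_congr rfl fun k _ => ?_
  have : Wᴴ * specM W (fun k => if e k < 0 then 1 else 0) * W =
      diagonal (fun k => ((if e k < 0 then 1 else 0 : ℝ) : ℂ)) := by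
    rw [specM]
    calc _ = (Wᴴ * W) * diagonal (fun k => ((if e k < 0 then 1 else 0 : ℝ) : ℂ)) * (Wᴴ * W) := by
          simp only [Matrix.mul_assoc]
      _ = _ := by rw [hW', Matrix.one_mul, Matrix.mul_one]
  rw [this, Matrix.diagonal_apply_eq, Complex.ofReal_re]
  split_ifs with h
  · rw [min_eq_left h.le, mul_one]
  · rw [min_eq_right (not_lt.1 h), mul_zero]

theorem specM_isHermitian (W : Matrix n n ℂ) (f : n → ℝ) : (specM W f).IsHermitian := by
  refine Matrix.isHermitian_mul_mul_conjTranspose _ ?_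
  rw [Matrix.isHermitian_diagonal_iff]
  intro i
  exact Complex.conj_ofReal _

theorem negTrace_specM {W : Matrix n n ℂ} (hW : W * Wᴴ = 1) (e : n → ℝ) :
    negTrace (specM W e) = ∑ k, min (e k) 0 := by
  have hW' : Wᴴ * W = 1 := mul_eq_one_comm.1 hW
  rw [negTrace, dif_pos (specM_isHermitian W e)]
  have h1 := (specM_isHermitian W e).roots_charpoly_eq_eigenvalues
  have h2 : (specM W e).charpoly = (diagonal (fun k => (e k : ℂ))).charpoly := by
    rw [specM, Matrix.mul_assoc, Matrix.charpoly_mul_comm, Matrix.mul_assoc, hW', Matrix.mul_one]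
  have h4 : (∏ k, (Polynomial.X - Polynomial.C (e k : ℂ))).roots =
      Multiset.map (fun k => (e k : ℂ)) Finset.univ.val := by
    rw [← Polynomial.roots_multiset_prod_X_sub_C (Multiset.map (fun k => (e k : ℂ)) _),
      Multiset.map_map]
    rfl
  rw [h2, Matrix.charpoly_diagonal, h4] at h1
  have h3 := congrArg (fun s => (Multiset.map (fun z : ℂ => min z.re 0) s).sum) h1
  simp only [Multiset.map_map] at h3
  exact h3.symm
end

theorem site_energy_nonneg {K c p U m M : ℝ} (hK : 0 ≤ K) (hc : 0 < c) (hp : 0 < p)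
    (hU1 : 4 * K / p ≤ U) (hU2 : K ^ 2 / c ≤ U) (hm : 0 ≤ m) (hmM : m ≤ M) :
    K * m ≤ c * (if M ≤ p / 4 then 1 else 0) + U * (m * M) := by
  have hU0 : 0 ≤ U := le_trans (by positivity) hU1
  split_ifs with h
  · rw [div_le_iff₀ hc] at hU2
    have h1 : U * (m * m) ≤ U * (m * M) := by gcongr
    suffices K * m ≤ c + U * (m * m) by linarith
    have h2 : c * (K * m) ≤ c * (c + U * (m * m)) := by
      nlinarith [sq_nonneg (c - K * m), mul_le_mul_of_nonneg_right hU2 (sq_nonneg m),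
        mul_nonneg hK hm]
    exact le_of_mul_le_mul_left h2 hc
  · rw [div_le_iff₀ hp] at hU1
    have h1 : U * (m * (p / 4)) ≤ U * (m * M) := by
      have := (not_le.1 h).le
      gcongr
    nlinarith

theorem norm_apply_le_half_add {n : Type} [Fintype n] {G : Matrix n n ℂ} (h0 : G.PosSemidef)
    (x y : n) : ‖G x y‖ ≤ ((G x x).re + (G y y).re) / 2 := by
  have h := norm_sq_apply_le h0 x y
  have := diag_re_nonneg h0 x
  have := diag_re_nonneg h0 y
  refine abs_le_of_sq_le_sq' (h.trans ?_) (by positivity) |>.2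
  nlinarith [sq_nonneg ((G x x).re - (G y y).re)]

theorem norm_apply_le_add_div {n : Type} [Fintype n] [DecidableEq n] {G : Matrix n n ℂ}
    (h0 : G.PosSemidef) (h1 : (1 - G).PosSemidef) {c : ℝ} (hc : 0 < c) (x y : n) :
    ‖G x y‖ ≤ c / 2 + (G x x).re / (2 * c) := by
  have h := norm_sq_apply_le h0 x y
  have hx := diag_re_nonneg h0 x
  have hy := diag_re_le_one h1 y
  have h2 : ‖G x y‖ ^ 2 ≤ (G x x).re := h.trans (by nlinarith)
  have h3 : ‖G x y‖ ≤ c / 2 + ‖G x y‖ ^ 2 / (2 * c) := by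
    have : c / 2 + ‖G x y‖ ^ 2 / (2 * c) - ‖G x y‖ = (c - ‖G x y‖) ^ 2 / (2 * c) := by
      field_simp
      ring
    have : 0 ≤ (c - ‖G x y‖) ^ 2 / (2 * c) := by positivity
    linarith
  refine h3.trans ?_
  gcongr

/-- If, for every density matrix, the excess of the one-particle energy over `E₀` controls both the
number of bonds on which the matrix vanishes and the number of sites of low density, then `E₀` is
a lower bound for the energy of a pair of density matrices at strong coupling. -/
theorem le_pair_energy {n : Type} [Fintype n] [DecidableEq n] {adj : n → n → Prop} {D a c p E₀ U : ℝ}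
    (hD : 0 ≤ D)
    (hrow : ∀ x, ∑ y, (if adj x y then (1 : ℝ) else 0) ≤ D)
    (hcol : ∀ y, ∑ x, (if adj x y then (1 : ℝ) else 0) ≤ D)
    {H : Matrix n n ℂ} (hH : H = (a : ℂ) • 1 - Matrix.of fun x y => if adj x y then (1 : ℂ) else 0)
    (hc : 0 < c) (hp : 0 < p)
    (hex : ∀ γ : Matrix n n ℂ, γ.PosSemidef → (1 - γ).PosSemidef →
      c * (∑ x, ∑ y, (if adj x y ∧ γ y x = 0 then (1 : ℝ) else 0)) +
        c * (∑ x, (if (γ x x).re ≤ p / 4 then (1 : ℝ) else 0)) ≤ (H * γ).trace.re - E₀)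
    (hU1 : 4 * (|a| + 2 * D * (1 / 2 + 1 / (2 * c))) / p ≤ U)
    (hU2 : (|a| + 2 * D * (1 / 2 + 1 / (2 * c))) ^ 2 / c ≤ U)
    {γu γd : Matrix n n ℂ} (u0 : γu.PosSemidef) (u1 : (1 - γu).PosSemidef)
    (d0 : γd.PosSemidef) (d1 : (1 - γd).PosSemidef) :
    E₀ ≤ (H * (γu + γd)).trace.re + U * ∑ x, (γu x x).re * (γd x x).re := by
  set C : ℝ := 1 / 2 + 1 / (2 * c) with hC
  have hC0 : 0 ≤ C := by positivity
  have hC1 : 1 / 2 ≤ C := by rw [hC]; linarith [show 0 ≤ 1 / (2 * c) by positivity]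
  have hC2 : 1 / (2 * c) ≤ C := by rw [hC]; linarith
  set K : ℝ := |a| + 2 * D * C with hK
  have hK0 : 0 ≤ K := by positivity
  set A : n → Prop := fun x => (γd x x).re ≤ (γu x x).re with hA
  set EA : Matrix n n ℂ := diagonal fun x => if A x then 1 else 0 with hEA
  set EB : Matrix n n ℂ := diagonal fun x => if A x then 0 else 1 with hEB
  set Γ : Matrix n n ℂ := EA * γu * EAᴴ + EB * γd * EBᴴ with hΓ
  have hΓa : ∀ x y, Γ x y = if A x then (if A y then γu x y else 0)
      else (if A y then 0 else γd x y) := fun x y => by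
    simp only [hΓ, hEA, hEB, Matrix.add_apply, Matrix.diagonal_conjTranspose,
      Matrix.mul_diagonal, Matrix.diagonal_mul, Pi.star_apply]
    split_ifs <;> simp
  have Γ0 : Γ.PosSemidef :=
    (u0.mul_mul_conjTranspose_same EA).add (d0.mul_mul_conjTranspose_same EB)
  have Γ1 : (1 - Γ).PosSemidef := by
    have h := (u1.mul_mul_conjTranspose_same EA).add (d1.mul_mul_conjTranspose_same EB)
    convert h using 1
    have : EA * EAᴴ + EB * EBᴴ = 1 := by
      rw [hEA, hEB, Matrix.diagonal_conjTranspose, Matrix.diagonal_conjTranspose,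
        Matrix.diagonal_mul_diagonal, Matrix.diagonal_mul_diagonal, Matrix.diagonal_add,
        ← Matrix.diagonal_one]
      congr 1
      ext x
      by_cases hx : A x <;> simp [hx]
    simp only [Matrix.mul_sub, Matrix.sub_mul, Matrix.mul_one]
    rw [← this, hΓ]
    abel
  set N : Matrix n n ℂ := γu + γd - Γ with hN
  set m : n → ℝ := fun x => min (γu x x).re (γd x x).re with hm
  set M : n → ℝ := fun x => max (γu x x).re (γd x x).re with hM
  have m0 : ∀ x, 0 ≤ m x := fun x => le_min (diag_re_nonneg u0 x) (diag_re_nonneg d0 x)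
  have hmA : ∀ x, A x → m x = (γd x x).re := fun x hx => min_eq_right hx
  have hmB : ∀ x, ¬ A x → m x = (γu x x).re := fun x hx => min_eq_left (not_le.1 hx).le
  have hMΓ : ∀ x, (Γ x x).re = M x := fun x => by
    rw [hΓa]
    by_cases hx : A x
    · simp only [hx, if_true, hM]; exact (max_eq_left hx).symm
    · simp only [hx, if_false, hM]; exact (max_eq_right (not_le.1 hx).le).symm
  have hNd : ∀ x, (N x x).re = m x := fun x => by
    rw [hN, Matrix.sub_apply, Complex.sub_re, hMΓ, Matrix.add_apply, Complex.add_re]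
    have := min_add_max (γu x x).re (γd x x).re
    simp only [hm, hM]
    linarith
  have hdiv : ∀ t : ℝ, 0 ≤ t → t / (2 * c) ≤ C * t := fun t ht => by
    rw [div_eq_mul_one_div, mul_comm]
    gcongr
  have hNo : ∀ x y, ‖N y x‖ ≤ c * (if Γ y x = 0 then 1 else 0) + C * (m x + m y) := fun x y => by
    have hcn : 0 ≤ c * (if Γ y x = 0 then (1 : ℝ) else 0) := by split_ifs <;> simp [hc.le]
    have mx := m0 x
    have my := m0 y
    rw [hN, Matrix.sub_apply, Matrix.add_apply]
    by_cases hx : A x <;> by_cases hy : A y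
    · have := norm_apply_le_half_add d0 y x
      rw [hΓa] at hcn ⊢
      simp only [hx, hy, if_true] at hcn ⊢
      rw [add_sub_cancel_left]
      rw [← hmA x hx, ← hmA y hy] at this
      nlinarith
    · have e1 : Γ y x = 0 := by rw [hΓa]; simp [hx, hy]
      rw [e1, if_pos rfl, sub_zero, mul_one]
      have h1 := norm_apply_le_add_div u0 u1 hc y x
      have h2 := norm_apply_le_add_div d0 d1 hc x y
      rw [← norm_star, d0.1.apply] at h2
      rw [← hmB y hy] at h1
      rw [← hmA x hx] at h2
      have := norm_add_le (γu y x) (γd y x)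
      linarith [hdiv _ mx, hdiv _ my]
    · have e1 : Γ y x = 0 := by rw [hΓa]; simp [hx, hy]
      rw [e1, if_pos rfl, sub_zero, mul_one]
      have h1 := norm_apply_le_add_div d0 d1 hc y x
      have h2 := norm_apply_le_add_div u0 u1 hc x y
      rw [← norm_star, u0.1.apply] at h2
      rw [← hmA y hy] at h1
      rw [← hmB x hx] at h2
      have := norm_add_le (γu y x) (γd y x)
      linarith [hdiv _ mx, hdiv _ my]
    · have := norm_apply_le_half_add u0 y x
      rw [hΓa] at hcn ⊢
      simp only [hx, hy, if_false] at hcn ⊢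
      rw [add_sub_cancel_right]
      rw [← hmB x hx, ← hmB y hy] at this
      nlinarith
  have htr : (H * N).trace.re = a * ∑ x, m x -
      ∑ x, ∑ y, (if adj x y then (1 : ℝ) else 0) * (N y x).re := by
    rw [hH, Matrix.sub_mul, Matrix.trace_sub, Complex.sub_re, Matrix.smul_mul, Matrix.one_mul,
      Matrix.trace_smul, smul_eq_mul, Complex.re_ofReal_mul]
    congr 1
    · rw [Matrix.trace, Complex.re_sum]
      simp only [Matrix.diag_apply, hNd]
    · rw [Matrix.trace, Complex.re_sum]
      refine Finset.sum_congr rfl fun x _ => ?_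
      rw [Matrix.diag_apply, Matrix.mul_apply, Complex.re_sum]
      refine Finset.sum_congr rfl fun y _ => ?_
      rw [Matrix.of_apply]
      split_ifs <;> simp
  have hoff : ∑ x, ∑ y, (if adj x y then (1 : ℝ) else 0) * (N y x).re ≤
      c * (∑ x, ∑ y, (if adj x y ∧ Γ y x = 0 then (1 : ℝ) else 0)) + 2 * D * C * ∑ x, m x := by
    have h1 : ∀ x y, (if adj x y then (1 : ℝ) else 0) * (N y x).re ≤
        c * (if adj x y ∧ Γ y x = 0 then (1 : ℝ) else 0) +
          C * m x * (if adj x y then (1 : ℝ) else 0) +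
          C * m y * (if adj x y then (1 : ℝ) else 0) := fun x y => by
      by_cases h : adj x y
      · have := (Complex.re_le_norm (N y x)).trans (hNo x y)
        simp only [h, if_true, true_and]
        linarith
      · simp [h]
    have h2 : ∑ x, ∑ y, (C * m x * (if adj x y then (1 : ℝ) else 0)) ≤ D * C * ∑ x, m x := by
      rw [Finset.mul_sum]
      refine Finset.sum_le_sum fun x _ => ?_
      rw [← Finset.mul_sum]
      have := mul_le_mul_of_nonneg_left (hrow x) (mul_nonneg hC0 (m0 x))
      linarith
    have h3 : ∑ x, ∑ y, (C * m y * (if adj x y then (1 : ℝ) else 0)) ≤ D * C * ∑ x, m x := by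
      rw [Finset.sum_comm, Finset.mul_sum]
      refine Finset.sum_le_sum fun x _ => ?_
      rw [← Finset.mul_sum]
      have := mul_le_mul_of_nonneg_left (hcol x) (mul_nonneg hC0 (m0 x))
      linarith
    have h4 := Finset.sum_le_sum fun x (_ : x ∈ Finset.univ) =>
      Finset.sum_le_sum fun y (_ : y ∈ Finset.univ) => h1 x y
    simp only [Finset.sum_add_distrib, ← Finset.mul_sum] at h2 h3 h4 ⊢
    linarith
  have hsum : (H * (γu + γd)).trace.re = (H * Γ).trace.re + (H * N).trace.re := by
    rw [← Complex.add_re, ← Matrix.trace_add, ← Matrix.mul_add, hN, add_sub_cancel]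
  have hsite : K * ∑ x, m x ≤ c * (∑ x, (if (Γ x x).re ≤ p / 4 then (1 : ℝ) else 0)) +
      U * ∑ x, (γu x x).re * (γd x x).re := by
    rw [Finset.mul_sum, Finset.mul_sum, Finset.mul_sum, ← Finset.sum_add_distrib]
    refine Finset.sum_le_sum fun x _ => ?_
    rw [hMΓ, ← min_mul_max (γu x x).re]
    exact site_energy_nonneg hK0 hc hp hU1 hU2 (m0 x) min_le_max
  have ha : -(|a| * ∑ x, m x) ≤ a * ∑ x, m x := by
    have : 0 ≤ ∑ x, m x := Finset.sum_nonneg fun x _ => m0 x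
    nlinarith [neg_abs_le a]
  have := hex Γ Γ0 Γ1
  rw [hK, add_mul] at hsite
  linarith

/-- The hypothesis of `le_pair_energy` for a Hamiltonian whose Fermi projection has entries bounded
below on bonds and on the diagonal, and which has few states near the Fermi level. -/
theorem excess_energy_count {n : Type} [Fintype n] [DecidableEq n] {adj : n → n → Prop}
    {W : Matrix n n ℂ} (hW : W * Wᴴ = 1) (e : n → ℝ) {ε p : ℝ} (hε : 0 < ε) (hp : 0 < p)
    (hν : ∀ x, (specM W (fun k => if |e k| < ε then 1 else 0) x x).re ≤ p ^ 2 / 64)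
    (hPd : ∀ x, p ≤ (specM W (fun k => if e k < 0 then 1 else 0) x x).re)
    (hPo : ∀ x y, adj x y → p ≤ (specM W (fun k => if e k < 0 then 1 else 0) y x).re)
    {γ : Matrix n n ℂ} (h0 : γ.PosSemidef) (h1 : (1 - γ).PosSemidef) :
    ε * p ^ 2 / 8 * (∑ x, ∑ y, (if adj x y ∧ γ y x = 0 then (1 : ℝ) else 0)) +
      ε * p ^ 2 / 8 * (∑ x, (if (γ x x).re ≤ p / 4 then (1 : ℝ) else 0)) ≤
      (specM W e * γ).trace.re - ∑ k, min (e k) 0 := by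
  obtain ⟨Y, hY, hE⟩ := excess_energy_bound hW e h0 h1 hν
  refine le_trans ?_ hE
  have hs : √(p ^ 2 / 64) = p / 8 := by
    rw [show p ^ 2 / 64 = (p / 8) ^ 2 by ring, Real.sqrt_sq (by positivity)]
  rw [hs] at hY
  have hpt : ∀ x y, (γ y x).re ≤ p / 4 →
      p ≤ (specM W (fun k => if e k < 0 then 1 else 0) y x).re → p ^ 2 / 4 ≤ ‖Y y x‖ ^ 2 := by
    intro x y hγ hP
    have h2 := hY y x
    have h3 := Complex.re_le_norm (specM W (fun k => if e k < 0 then 1 else 0) y x - γ y x)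
    rw [Complex.sub_re] at h3
    nlinarith
  have hoff : p ^ 2 / 4 * (∑ x, ∑ y, (if adj x y ∧ γ y x = 0 then (1 : ℝ) else 0)) ≤
      ∑ x, ∑ y, ‖Y x y‖ ^ 2 := by
    rw [Finset.sum_comm (f := fun x y => ‖Y x y‖ ^ 2), Finset.mul_sum]
    refine Finset.sum_le_sum fun x _ => ?_
    rw [Finset.mul_sum]
    refine Finset.sum_le_sum fun y _ => ?_
    split_ifs with h
    · rw [mul_one]
      exact hpt x y (by rw [h.2]; simp; positivity) (hPo x y h.1)
    · simp
  have hdi : p ^ 2 / 4 * (∑ x, (if (γ x x).re ≤ p / 4 then (1 : ℝ) else 0)) ≤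
      ∑ x, ∑ y, ‖Y x y‖ ^ 2 := by
    rw [Finset.mul_sum]
    refine Finset.sum_le_sum fun x _ => ?_
    refine le_trans ?_ (Finset.single_le_sum (f := fun y => ‖Y x y‖ ^ 2)
      (fun y _ => sq_nonneg _) (Finset.mem_univ x))
    split_ifs with h
    · rw [mul_one]
      exact hpt x x h (hPd x)
    · simp
  nlinarith [mul_le_mul_of_nonneg_left (add_le_add hoff hdi) hε.le]

/-- The real part of the standard additive character, `j ↦ cos (2πj/L)`. -/
def cosZ {L : ℕ} [NeZero L] (j : ZMod L) : ℝ := (ZMod.stdAddChar j : ℂ).re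

/-- The eigenvalue `2 ∑ ν, cos (2πk_ν/L)` of the adjacency matrix of the torus. -/
def band {d L : ℕ} [NeZero L] (k : Lam d L) : ℝ := 2 * ∑ ν, cosZ (k ν)

/-- The unitary matrix of plane waves on the torus. -/
def planeWaves (d L : ℕ) [NeZero L] : Matrix (Lam d L) (Lam d L) ℂ :=
  Matrix.of fun x k => ∏ ν, (((√(L : ℝ) : ℝ) : ℂ)⁻¹ * ZMod.stdAddChar (x ν * k ν))

theorem stdAddChar_conj {L : ℕ} [NeZero L] (j : ZMod L) :
    (starRingEnd ℂ) (ZMod.stdAddChar j) = ZMod.stdAddChar (-j) :=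
  (AddChar.map_neg_eq_conj _ _).symm

theorem cosZ_neg {L : ℕ} [NeZero L] (j : ZMod L) : cosZ (-j) = cosZ j := by
  rw [cosZ, ← stdAddChar_conj, Complex.conj_re, cosZ]

theorem stdAddChar_sum {ι : Type} [Fintype ι] {L : ℕ} [NeZero L] (f : ι → ZMod L) :
    (ZMod.stdAddChar (∑ i, f i) : ℂ) = ∏ i, ZMod.stdAddChar (f i) :=
  map_prod (ZMod.stdAddChar (N := L)).toMonoidHom (fun i => Multiplicative.ofAdd (f i)) _

theorem planeWaves_mul_star {d L : ℕ} [NeZero L] (x y k : Lam d L) :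
    planeWaves d L x k * star (planeWaves d L y k) =
      ∏ ν, ((L : ℂ)⁻¹ * ZMod.stdAddChar (k ν * (x ν - y ν))) := by
  simp only [planeWaves, Matrix.of_apply, Complex.star_def, map_prod, ← Finset.prod_mul_distrib]
  refine Finset.prod_congr rfl fun ν _ => ?_
  rw [map_mul (starRingEnd ℂ), stdAddChar_conj, map_inv₀, Complex.conj_ofReal]
  have h1 : ((√(L : ℝ) : ℝ) : ℂ)⁻¹ * ((√(L : ℝ) : ℝ) : ℂ)⁻¹ = (L : ℂ)⁻¹ := by
    rw [← mul_inv, ← Complex.ofReal_mul, Real.mul_self_sqrt (Nat.cast_nonneg _)]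
    simp
  have h2 : ZMod.stdAddChar (k ν * (x ν - y ν)) =
      ZMod.stdAddChar (x ν * k ν) * (ZMod.stdAddChar (-(y ν * k ν)) : ℂ) := by
    rw [← AddChar.map_add_eq_mul]
    congr 1
    ring
  rw [h2, ← h1]
  ring

theorem planeWaves_unitary (d L : ℕ) [NeZero L] : planeWaves d L * (planeWaves d L)ᴴ = 1 := by
  ext x y
  rw [Matrix.mul_apply]
  simp only [Matrix.conjTranspose_apply, planeWaves_mul_star]
  rw [← Fintype.prod_sum (fun ν (j : ZMod L) => (L : ℂ)⁻¹ * ZMod.stdAddChar (j * (x ν - y ν)))]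
  have h : ∀ ν, ∑ j : ZMod L, (L : ℂ)⁻¹ * ZMod.stdAddChar (j * (x ν - y ν)) =
      if x ν = y ν then 1 else 0 := fun ν => by
    rw [← Finset.mul_sum, AddChar.sum_mulShift _ (ZMod.isPrimitive_stdAddChar L), ZMod.card]
    have : (L : ℂ) ≠ 0 := Nat.cast_ne_zero.2 (NeZero.ne L)
    by_cases hx : x ν = y ν
    · simp [hx, this]
    · simp [hx, sub_ne_zero.2 hx]
  simp only [h]
  rw [Matrix.one_apply, Finset.prod_ite_zero]
  simp [funext_iff]

theorem specM_planeWaves_apply_re {d L : ℕ} [NeZero L] (f : Lam d L → ℝ) (x y : Lam d L) :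
    (specM (planeWaves d L) f x y).re =
      ((L : ℝ) ^ d)⁻¹ * ∑ k, f k * cosZ (∑ ν, k ν * (x ν - y ν)) := by
  rw [specM, Matrix.mul_apply, Complex.re_sum, Finset.mul_sum]
  refine Finset.sum_congr rfl fun k _ => ?_
  rw [Matrix.mul_diagonal, Matrix.conjTranspose_apply, mul_right_comm, planeWaves_mul_star,
    Finset.prod_mul_distrib, ← stdAddChar_sum, Finset.prod_const, Finset.card_univ,
    Fintype.card_fin, cosZ]
  have : ((L : ℂ)⁻¹) ^ d = (((L : ℝ) ^ d)⁻¹ : ℝ) := by push_cast; rw [inv_pow]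
  rw [this, mul_assoc, Complex.re_ofReal_mul, Complex.re_mul_ofReal]
  ring

/-- The indicator of nearest neighbors as a sum over the `2d` unit shifts. -/
theorem ite_isNN {R : Type} [Semiring R] {d L : ℕ} (hL : 3 ≤ L) (x y : Lam d L) :
    (if isNN x y then (1 : R) else 0) = ∑ ν, ((if y = x + Pi.single ν 1 then (1 : R) else 0) +
      (if y = x - Pi.single ν 1 then 1 else 0)) := by
  have : NeZero L := ⟨by omega⟩
  have : Fact (1 < L) := ⟨by omega⟩
  have : Fact (2 < L) := ⟨by omega⟩
  have hne : (1 : ZMod L) ≠ -1 := ZMod.neg_one_ne_one.symm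
  have single_ne : ∀ ν ν' : Fin d, (Pi.single ν 1 : Lam d L) ≠ -Pi.single ν' 1 := fun ν ν' h => by
    have := congrFun h ν
    rw [Pi.single_eq_same, Pi.neg_apply] at this
    by_cases hν : ν = ν'
    · subst hν
      rw [Pi.single_eq_same] at this
      exact hne this
    · rw [Pi.single_eq_of_ne hν, neg_zero] at this
      exact one_ne_zero this
  have single_inj : ∀ ν ν' : Fin d, (Pi.single ν 1 : Lam d L) = Pi.single ν' 1 → ν = ν' :=
    fun ν ν' h => by
      by_contra hν
      have := congrFun h ν
      rw [Pi.single_eq_same, Pi.single_eq_of_ne hν] at this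
      exact one_ne_zero this
  have hiff : isNN x y ↔ ∃ ν, y = x + Pi.single ν 1 ∨ y = x - Pi.single ν 1 := by
    refine exists_congr fun ν => ⟨?_, ?_⟩
    · rintro ⟨h1 | h1, h2⟩
      · right
        ext μ
        by_cases hμ : μ = ν
        · subst hμ; simp [h1]
        · simp [hμ, h2 μ hμ]
      · left
        ext μ
        by_cases hμ : μ = ν
        · subst hμ; simp [h1]
        · simp [hμ, h2 μ hμ]
    · rintro (h | h)
      · subst h
        exact ⟨Or.inr (by simp), fun μ hμ => by simp [hμ]⟩
      · subst h
        exact ⟨Or.inl (by simp), fun μ hμ => by simp [hμ]⟩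
  by_cases h : isNN x y
  · rw [if_pos h]
    obtain ⟨ν, h | h⟩ := hiff.1 h
    · subst h
      rw [Finset.sum_eq_single ν]
      · rw [if_pos rfl, if_neg, add_zero]
        rw [sub_eq_add_neg]
        exact fun h => single_ne ν ν (add_left_cancel h)
      · intro ν' _ hν'
        rw [if_neg, if_neg, add_zero]
        · rw [sub_eq_add_neg]
          exact fun h => single_ne ν ν' (add_left_cancel h)
        · exact fun h => hν' (single_inj _ _ (add_left_cancel h)).symm
      · simp
    · subst h
      rw [Finset.sum_eq_single ν]
      · rw [if_pos rfl, if_neg, zero_add]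
        rw [sub_eq_add_neg]
        exact fun h => single_ne ν ν (add_left_cancel h).symm
      · intro ν' _ hν'
        rw [if_neg, if_neg, add_zero]
        · exact fun h => hν' (single_inj _ _ (sub_right_injective h)).symm
        · rw [sub_eq_add_neg]
          exact fun h => single_ne ν' ν (add_left_cancel h).symm
      · simp
  · rw [if_neg h, Finset.sum_eq_zero]
    intro ν _
    rw [if_neg, if_neg, add_zero]
    · exact fun h' => h (hiff.2 ⟨ν, Or.inr h'⟩)
    · exact fun h' => h (hiff.2 ⟨ν, Or.inl h'⟩)

theorem isNN_comm {d L : ℕ} {x y : Lam d L} : isNN x y ↔ isNN y x :=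
  exists_congr fun _ => and_congr (or_comm.trans (or_congr eq_comm eq_comm))
    (forall₂_congr fun _ _ => eq_comm)

theorem sum_ite_isNN {d L : ℕ} [NeZero L] (hL : 3 ≤ L) (x : Lam d L) :
    ∑ y, (if isNN x y then (1 : ℝ) else 0) = 2 * d := by
  simp only [ite_isNN hL]
  rw [Finset.sum_comm]
  simp only [Finset.sum_add_distrib, Finset.sum_ite_eq', Finset.mem_univ, if_true]
  simp
  ring

theorem planeWaves_add_single {d L : ℕ} [NeZero L] (x k : Lam d L) (ν : Fin d) (s : ZMod L) :
    planeWaves d L (x + Pi.single ν s) k = ZMod.stdAddChar (s * k ν) * planeWaves d L x k := by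
  simp only [planeWaves, Matrix.of_apply, Finset.prod_mul_distrib, ← stdAddChar_sum]
  have : ∑ ν', (x + Pi.single ν s : Lam d L) ν' * k ν' = s * k ν + ∑ ν', x ν' * k ν' := by
    simp only [Pi.add_apply, add_mul, Finset.sum_add_distrib]
    rw [add_comm, Finset.sum_eq_single ν]
    · simp
    · intro ν' _ h; simp [h]
    · simp
  rw [this, AddChar.map_add_eq_mul]
  ring

theorem hamiltonian_eq_specM {d L : ℕ} [NeZero L] (hL : 3 ≤ L) (μ : ℝ) :
    -(lap d L) - (μ : ℂ) • 1 = specM (planeWaves d L) (fun k => 2 * d - μ - band k) := by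
  have hT : (Matrix.of fun x y : Lam d L => if isNN x y then (1 : ℂ) else 0) * planeWaves d L =
      planeWaves d L * diagonal (fun k => (band k : ℂ)) := by
    ext x k
    rw [Matrix.mul_diagonal, Matrix.mul_apply]
    simp only [Matrix.of_apply, ite_isNN hL, Finset.sum_mul, add_mul]
    rw [Finset.sum_comm]
    simp only [Finset.sum_add_distrib, ite_mul, one_mul, zero_mul, Finset.sum_ite_eq',
      Finset.mem_univ, if_true]
    have h1 : ∀ ν, planeWaves d L (x - Pi.single ν 1) k =
        ZMod.stdAddChar (-(k ν)) * planeWaves d L x k := fun ν => by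
      rw [sub_eq_add_neg, ← Pi.single_neg, planeWaves_add_single, neg_one_mul]
    simp only [h1, planeWaves_add_single, one_mul]
    rw [← Finset.sum_add_distrib, band, Complex.ofReal_mul, Complex.ofReal_sum, Finset.mul_sum,
      Finset.mul_sum]
    refine Finset.sum_congr rfl fun ν _ => ?_
    rw [← add_mul, ← stdAddChar_conj, Complex.add_conj, cosZ]
    push_cast
    ring
  have hT' : (Matrix.of fun x y : Lam d L => if isNN x y then (1 : ℂ) else 0) =
      specM (planeWaves d L) band := by
    rw [specM, ← hT, Matrix.mul_assoc, planeWaves_unitary, Matrix.mul_one]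
  have hd : (diagonal fun k : Lam d L => ((2 * d - μ - band k : ℝ) : ℂ)) =
      (2 * (d : ℂ) - μ) • 1 - diagonal fun k => (band k : ℂ) := by
    rw [← Matrix.diagonal_one, ← Matrix.diagonal_smul, Matrix.diagonal_sub]
    simp
  rw [lap, hT', specM, specM, hd, Matrix.mul_sub, Matrix.sub_mul, Matrix.mul_smul,
    Matrix.smul_mul, Matrix.mul_one, planeWaves_unitary, sub_smul]
  abel

theorem cosZ_eq_cos {L : ℕ} [NeZero L] (j : ZMod L) :
    cosZ j = Real.cos (2 * Real.pi * j.valMinAbs / L) := by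
  have h := ZMod.stdAddChar_coe (N := L) j.valMinAbs
  rw [ZMod.coe_valMinAbs] at h
  rw [cosZ, h, ← Complex.exp_ofReal_mul_I_re]
  congr 2
  push_cast
  ring

theorem cosZ_le_one {L : ℕ} [NeZero L] (j : ZMod L) : cosZ j ≤ 1 := by
  rw [cosZ_eq_cos]
  exact Real.cos_le_one _

theorem le_cosZ {L : ℕ} [NeZero L] (j : ZMod L) :
    1 - 2 * Real.pi ^ 2 * ((j.valMinAbs : ℝ) / L) ^ 2 ≤ cosZ j := by
  rw [cosZ_eq_cos]
  refine le_trans (le_of_eq ?_) (Real.one_sub_sq_div_two_le_cos)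
  ring

theorem cosZ_le {L : ℕ} [NeZero L] (j : ZMod L) :
    cosZ j ≤ 1 - 8 * ((j.valMinAbs : ℝ) / L) ^ 2 := by
  rw [cosZ_eq_cos]
  have hL : (0 : ℝ) < L := Nat.cast_pos.2 (NeZero.pos L)
  have hpi := Real.pi_pos
  refine (Real.cos_le_one_sub_mul_cos_sq ?_).trans (le_of_eq ?_)
  · have h := ZMod.valMinAbs_mem_Ioc j
    have h1 : -(L : ℝ) ≤ j.valMinAbs * 2 := by exact_mod_cast h.1.le
    have h2 : (j.valMinAbs : ℝ) * 2 ≤ L := by exact_mod_cast h.2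
    rw [abs_le]
    constructor
    · rw [le_div_iff₀ hL]; nlinarith
    · rw [div_le_iff₀ hL]; nlinarith
  · field_simp
    ring

theorem card_cosZ_near_one_le {L : ℕ} [NeZero L] {η : ℝ} (hη : 0 ≤ η) :
    ((Finset.univ.filter fun j : ZMod L => 1 - 8 * η ^ 2 ≤ cosZ j).card : ℝ) ≤
      2 * η * L + 1 := by
  have hL : (0 : ℝ) < L := Nat.cast_pos.2 (NeZero.pos L)
  have hsub : ((Finset.univ.filter fun j : ZMod L => 1 - 8 * η ^ 2 ≤ cosZ j).card) ≤
      (Finset.Icc (-(⌊η * L⌋₊ : ℤ)) ⌊η * L⌋₊).card := by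
    refine Finset.card_le_card_of_injOn ZMod.valMinAbs ?_ (ZMod.injective_valMinAbs.injOn)
    intro j hj
    have h1 := (Finset.mem_filter.1 hj).2.trans (cosZ_le j)
    have h2 : ((j.valMinAbs : ℝ) / L) ^ 2 ≤ η ^ 2 := by linarith
    have h3 := abs_le_of_sq_le_sq h2 hη
    rw [abs_div, abs_of_pos hL, div_le_iff₀ hL] at h3
    have h4 : j.valMinAbs.natAbs ≤ ⌊η * L⌋₊ := by
      apply Nat.le_floor
      rw [Nat.cast_natAbs]
      exact_mod_cast h3
    rw [Finset.coe_Icc, Set.mem_Icc]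
    omega
  have h5 : (Finset.Icc (-(⌊η * L⌋₊ : ℤ)) ⌊η * L⌋₊).card = 2 * ⌊η * L⌋₊ + 1 := by
    rw [Int.card_Icc]
    omega
  rw [h5] at hsub
  have h6 := Nat.floor_le (mul_nonneg hη hL.le)
  have h7 : ((Finset.univ.filter fun j : ZMod L => 1 - 8 * η ^ 2 ≤ cosZ j).card : ℝ) ≤
      2 * (⌊η * L⌋₊ : ℝ) + 1 := by exact_mod_cast hsub
  linarith

theorem le_card_cosZ_near_one {L : ℕ} [NeZero L] {r : ℝ} (hr : 0 < r) (hr2 : r ≤ 1 / 2) :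
    r * L ≤ ((Finset.univ.filter fun j : ZMod L => 1 - 2 * Real.pi ^ 2 * r ^ 2 ≤ cosZ j).card : ℝ)
      := by
  have hL : (0 : ℝ) < L := Nat.cast_pos.2 (NeZero.pos L)
  have hfl := Nat.floor_le (mul_nonneg hr.le hL.le)
  have hhalf : ∀ i : ℕ, i ≤ ⌊r * L⌋₊ → i ≤ L / 2 := fun i hi => by
    rw [Nat.le_div_iff_mul_le two_pos]
    have h1 : (i : ℝ) ≤ r * L := (Nat.cast_le.2 hi).trans hfl
    have : (i : ℝ) * 2 ≤ L := by nlinarith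
    exact_mod_cast this
  have hle : (Finset.range (⌊r * L⌋₊ + 1)).card ≤
      (Finset.univ.filter fun j : ZMod L => 1 - 2 * Real.pi ^ 2 * r ^ 2 ≤ cosZ j).card := by
    refine Finset.card_le_card_of_injOn (fun i : ℕ => (i : ZMod L)) ?_ ?_
    · intro i hi
      have hi' : i ≤ ⌊r * L⌋₊ := Nat.lt_succ_iff.1 (Finset.mem_range.1 hi)
      refine Finset.mem_filter.2 ⟨Finset.mem_univ _, le_trans ?_ (le_cosZ _)⟩
      rw [ZMod.valMinAbs_natCast_of_le_half (hhalf i hi'), Int.cast_natCast]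
      have h1 : (i : ℝ) / L ≤ r := by
        rw [div_le_iff₀ hL]
        exact (Nat.cast_le.2 hi').trans hfl
      gcongr
    · intro i hi j hj hij
      have hi' := hhalf i (Nat.lt_succ_iff.1 (Finset.mem_range.1 hi))
      have hj' := hhalf j (Nat.lt_succ_iff.1 (Finset.mem_range.1 hj))
      have := congrArg ZMod.valMinAbs hij
      simp only [ZMod.valMinAbs_natCast_of_le_half hi', ZMod.valMinAbs_natCast_of_le_half hj']
        at this
      exact_mod_cast this
  rw [Finset.card_range] at hle
  have h2 := (Nat.lt_floor_add_one (r * L)).le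
  refine h2.trans ?_
  exact_mod_cast hle

theorem one_sub_cosZ_sub_mul_add {L : ℕ} [NeZero L] (j i : ZMod L) :
    (1 - cosZ (j - i)) * (1 - cosZ (j + i)) = (cosZ j - cosZ i) ^ 2 := by
  have hn : ∀ j : ZMod L, cosZ j ^ 2 + (ZMod.stdAddChar j : ℂ).im ^ 2 = 1 := fun j => by
    have h : (ZMod.stdAddChar j : ℂ) * (starRingEnd ℂ) (ZMod.stdAddChar j) = 1 := by
      rw [stdAddChar_conj, ← AddChar.map_add_eq_mul, add_neg_cancel, AddChar.map_zero_eq_one]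
    rw [Complex.mul_conj] at h
    have h' : Complex.normSq (ZMod.stdAddChar j : ℂ) = 1 := by exact_mod_cast h
    rw [Complex.normSq_apply] at h'
    rw [cosZ]
    linarith
  have h1 : cosZ (j + i) = cosZ j * cosZ i -
      (ZMod.stdAddChar j : ℂ).im * (ZMod.stdAddChar i : ℂ).im := by
    simp only [cosZ]
    rw [AddChar.map_add_eq_mul, Complex.mul_re]
  have h2 : cosZ (j - i) = cosZ j * cosZ i +
      (ZMod.stdAddChar j : ℂ).im * (ZMod.stdAddChar i : ℂ).im := by
    simp only [cosZ]
    rw [sub_eq_add_neg, AddChar.map_add_eq_mul, ← stdAddChar_conj, Complex.mul_re,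
      Complex.conj_re, Complex.conj_im]
    ring
  rw [h1, h2]
  have hj := hn j
  have hi := hn i
  linear_combination (-(1 - cosZ i ^ 2)) * hj - (ZMod.stdAddChar j : ℂ).im ^ 2 * hi

theorem card_cosZ_near_le {L : ℕ} [NeZero L] {η : ℝ} (hη : 0 ≤ η) (s : ℝ) :
    ((Finset.univ.filter fun j : ZMod L => |s - 2 * cosZ j| < 8 * η ^ 2).card : ℝ) ≤
      4 * η * L + 2 := by
  have hL : (0 : ℝ) < L := Nat.cast_pos.2 (NeZero.pos L)
  rcases (Finset.univ.filter fun j : ZMod L => |s - 2 * cosZ j| < 8 * η ^ 2).eq_empty_or_nonempty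
    with h | ⟨i, hi⟩
  · rw [h]
    simp only [Finset.card_empty, Nat.cast_zero]
    positivity
  · set S := Finset.univ.filter fun j : ZMod L => 1 - 8 * η ^ 2 ≤ cosZ j with hS
    have hsub : (Finset.univ.filter fun j : ZMod L => |s - 2 * cosZ j| < 8 * η ^ 2) ⊆
        S.image (fun j => j + i) ∪ S.image (fun j => j - i) := by
      intro j hj
      have h1 := abs_lt.1 (Finset.mem_filter.1 hi).2
      have h2 := abs_lt.1 (Finset.mem_filter.1 hj).2
      have h3 : (cosZ j - cosZ i) ^ 2 ≤ (8 * η ^ 2) ^ 2 := by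
        apply sq_le_sq'
        · linarith
        · linarith
      rw [← one_sub_cosZ_sub_mul_add] at h3
      rw [Finset.mem_union, Finset.mem_image, Finset.mem_image]
      by_cases h4 : 1 - 8 * η ^ 2 ≤ cosZ (j - i)
      · exact Or.inl ⟨j - i, Finset.mem_filter.2 ⟨Finset.mem_univ _, h4⟩, sub_add_cancel _ _⟩
      · refine Or.inr ⟨j + i, Finset.mem_filter.2 ⟨Finset.mem_univ _, ?_⟩, add_sub_cancel_right _ _⟩
        by_contra h5
        rw [not_le] at h4 h5
        have h6 : 0 ≤ 8 * η ^ 2 := by positivity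
        have h7 : (8 * η ^ 2) * (8 * η ^ 2) < (1 - cosZ (j - i)) * (1 - cosZ (j + i)) :=
          mul_lt_mul'' (by linarith) (by linarith) h6 h6
        linarith
    have hcard : (Finset.univ.filter fun j : ZMod L => |s - 2 * cosZ j| < 8 * η ^ 2).card ≤
        S.card + S.card :=
      (Finset.card_le_card hsub).trans ((Finset.card_union_le _ _).trans
        (add_le_add Finset.card_image_le Finset.card_image_le))
    have h8 := card_cosZ_near_one_le (L := L) hη
    have h9 : ((Finset.univ.filter fun j : ZMod L => |s - 2 * cosZ j| < 8 * η ^ 2).card : ℝ) ≤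
        S.card + S.card := by exact_mod_cast hcard
    linarith

/-- Few states lie near a given energy level. -/
theorem sum_near_level_le {d L : ℕ} [NeZero L] (hd : 1 ≤ d) {η : ℝ} (hη : 0 ≤ η) (s : ℝ) :
    ∑ k : Lam d L, (if |s - band k| < 8 * η ^ 2 then (1 : ℝ) else 0) ≤
      (4 * η + 2 / L) * (L : ℝ) ^ d := by
  obtain ⟨d, rfl⟩ : ∃ d', d = d' + 1 := ⟨d - 1, by omega⟩
  have hL : (0 : ℝ) < L := Nat.cast_pos.2 (NeZero.pos L)
  rw [← (Fin.consEquiv (fun _ : Fin (d + 1) => ZMod L)).sum_comp, Fintype.sum_prod_type,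
    Finset.sum_comm]
  have h : ∀ k : Lam d L, ∑ j : ZMod L,
      (if |s - band (Fin.consEquiv (fun _ : Fin (d + 1) => ZMod L) (j, k))| < 8 * η ^ 2
        then (1 : ℝ) else 0) ≤ 4 * η * L + 2 := fun k => by
    refine le_trans (le_of_eq ?_) (card_cosZ_near_le hη (s - band k))
    rw [Finset.sum_boole]
    congr 2
    ext j
    have : band (Fin.consEquiv (fun _ : Fin (d + 1) => ZMod L) (j, k) : Lam (d + 1) L) =
        2 * cosZ j + band k := by
      simp only [band, Fin.consEquiv_apply, Fin.sum_univ_succ, Fin.cons_zero, Fin.cons_succ]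
      ring
    simp only [Finset.mem_filter, Finset.mem_univ, true_and]
    rw [this, ← sub_sub, sub_right_comm]
  refine (Finset.sum_le_sum fun k _ => h k).trans (le_of_eq ?_)
  rw [Finset.sum_const, Finset.card_univ, Fintype.card_fun, ZMod.card, Fintype.card_fin,
    nsmul_eq_mul, Nat.cast_pow, pow_succ]
  field_simp

theorem band_le {d L : ℕ} [NeZero L] (k : Lam d L) : band k ≤ 2 * d := by
  have : ∑ ν, cosZ (k ν) ≤ ∑ _ν : Fin d, (1 : ℝ) := Finset.sum_le_sum fun ν _ => cosZ_le_one _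
  rw [band]
  simpa using this

theorem sum_band_above_ge {d : ℕ} (hd : 1 ≤ d) {s : ℝ} (hs : 0 ≤ s) (hs2 : s < 2 * d) :
    ∃ p : ℝ, 0 < p ∧ ∀ (L : ℕ) [NeZero L],
      p * (L : ℝ) ^ d ≤ ∑ k : Lam d L, (if s < band k then band k else 0) := by
  have hd0 : (0 : ℝ) < d := Nat.cast_pos.2 (by omega)
  have hpi := Real.pi_pos
  set r : ℝ := min (1 / 2) ((2 * d - s) / (8 * d * Real.pi ^ 2)) with hr
  have hr0 : 0 < r := lt_min (by norm_num) (div_pos (by linarith) (by positivity))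
  have hr1 : r ≤ 1 / 2 := min_le_left _ _
  have hr2 : r * (8 * d * Real.pi ^ 2) ≤ 2 * d - s := by
    rw [← le_div_iff₀ (by positivity)]
    exact min_le_right _ _
  refine ⟨(s + 2 * d) / 2 * r ^ d, by positivity, fun L _ => ?_⟩
  have hL : (0 : ℝ) < L := Nat.cast_pos.2 (NeZero.pos L)
  set S := Finset.univ.filter fun j : ZMod L => 1 - 2 * Real.pi ^ 2 * r ^ 2 ≤ cosZ j with hS
  have hband : ∀ k ∈ Fintype.piFinset (fun _ : Fin d => S), (s + 2 * d) / 2 ≤ band k := by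
    intro k hk
    rw [Fintype.mem_piFinset] at hk
    have h1 : ∑ _ν : Fin d, (1 - 2 * Real.pi ^ 2 * r ^ 2) ≤ ∑ ν, cosZ (k ν) :=
      Finset.sum_le_sum fun ν _ => (Finset.mem_filter.1 (hk ν)).2
    rw [Finset.sum_const, Finset.card_univ, Fintype.card_fin, nsmul_eq_mul] at h1
    have h2 : r ^ 2 ≤ r := by nlinarith
    have h3 : (8 * d * Real.pi ^ 2) * r ^ 2 ≤ (8 * d * Real.pi ^ 2) * r := by gcongr
    rw [band]
    nlinarith
  have h1 : ∑ k ∈ Fintype.piFinset (fun _ : Fin d => S), (if s < band k then band k else 0) ≤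
      ∑ k : Lam d L, (if s < band k then band k else 0) := by
    refine Finset.sum_le_sum_of_subset_of_nonneg (Finset.subset_univ _) fun k _ _ => ?_
    split_ifs with h
    · linarith
    · exact le_rfl
  refine le_trans ?_ h1
  have h2 : ∑ _k ∈ Fintype.piFinset (fun _ : Fin d => S), (s + 2 * d) / 2 ≤
      ∑ k ∈ Fintype.piFinset (fun _ : Fin d => S), (if s < band k then band k else 0) := by
    refine Finset.sum_le_sum fun k hk => ?_
    have := hband k hk
    rw [if_pos (by linarith)]
    exact this
  refine le_trans ?_ h2
  rw [Finset.sum_const, Fintype.card_piFinset_const, nsmul_eq_mul, Nat.cast_pow]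
  have h3 : (r * L) ^ d ≤ (S.card : ℝ) ^ d := by
    have := le_card_cosZ_near_one (L := L) hr0 hr1
    gcongr
  rw [mul_pow] at h3
  calc _ = (r ^ d * (L : ℝ) ^ d) * ((s + 2 * d) / 2) := by ring
    _ ≤ _ := by gcongr

theorem cosZ_add_half {L : ℕ} [NeZero L] (hL : Even L) (j : ZMod L) :
    cosZ (j + ((L / 2 : ℕ) : ZMod L)) = -cosZ j := by
  have hL0 : (L : ℂ) ≠ 0 := Nat.cast_ne_zero.2 (NeZero.ne L)
  have h : (ZMod.stdAddChar (((L / 2 : ℕ) : ℤ) : ZMod L) : ℂ) = -1 := by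
    rw [ZMod.stdAddChar_coe, ← Complex.exp_pi_mul_I]
    congr 1
    have : (((L / 2 : ℕ) : ℤ) : ℂ) = L / 2 := by
      rw [Int.cast_natCast, Nat.cast_div hL.two_dvd two_ne_zero]
      simp
    rw [this]
    field_simp
  rw [Int.cast_natCast] at h
  rw [cosZ, AddChar.map_add_eq_mul, h, mul_neg_one, Complex.neg_re, cosZ]

theorem sum_comp_neg_band {d L : ℕ} [NeZero L] (hL : Even L) (F : ℝ → ℝ) :
    ∑ k : Lam d L, F (-band k) = ∑ k : Lam d L, F (band k) := by
  rw [← Equiv.sum_comp (Equiv.addRight (fun _ : Fin d => ((L / 2 : ℕ) : ZMod L)))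
    (fun k : Lam d L => F (band k))]
  refine Finset.sum_congr rfl fun k _ => ?_
  congr 1
  simp only [band, Equiv.coe_addRight, Pi.add_apply, cosZ_add_half hL, Finset.sum_neg_distrib]
  ring

theorem sum_band_fermi_ge {d : ℕ} (hd : 1 ≤ d) {t : ℝ} (ht : -(2 * d) < t) (ht2 : t < 2 * d) :
    ∃ p : ℝ, 0 < p ∧ ∀ (L : ℕ) [NeZero L], Even L →
      p * (L : ℝ) ^ d ≤ ∑ k : Lam d L, (if t < band k then band k else 0) := by
  rcases le_or_gt 0 t with h | h
  · obtain ⟨p, hp, H⟩ := sum_band_above_ge hd h ht2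
    exact ⟨p, hp, fun L _ _ => H L⟩
  · obtain ⟨p, hp, H⟩ := sum_band_above_ge hd (s := -t) (by linarith) (by linarith)
    refine ⟨p, hp, fun L _ hL => (H L).trans ?_⟩
    have h0 : ∑ k : Lam d L, band k = 0 := by
      have := sum_comp_neg_band (d := d) hL id
      simp only [id, Finset.sum_neg_distrib] at this
      linarith
    rw [← sum_comp_neg_band hL (fun b => if t < b then b else 0)]
    have h1 : ∑ k : Lam d L, (if -t < band k then band k else 0) ≤
        ∑ k : Lam d L, ((if t < -band k then -band k else 0) + band k) := by
      refine Finset.sum_le_sum fun k _ => ?_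
      split_ifs <;> linarith
    rwa [Finset.sum_add_distrib, h0, add_zero] at h1

/-- By permutation symmetry all coordinates contribute equally to the kinetic energy. -/
theorem sum_comp_band_mul_cosZ {d L : ℕ} [NeZero L] (F : ℝ → ℝ) (ν : Fin d) :
    2 * d * ∑ k : Lam d L, F (band k) * cosZ (k ν) = ∑ k : Lam d L, F (band k) * band k := by
  have h : ∀ ν', ∑ k : Lam d L, F (band k) * cosZ (k ν') =
      ∑ k : Lam d L, F (band k) * cosZ (k ν) := fun ν' => by
    rw [← (Equiv.arrowCongr (Equiv.swap ν ν') (Equiv.refl (ZMod L))).sum_comp]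
    refine Finset.sum_congr rfl fun k _ => ?_
    have h1 : band (Equiv.arrowCongr (Equiv.swap ν ν') (Equiv.refl (ZMod L)) k : Lam d L) =
        band k := by
      rw [band, band, ← Equiv.sum_comp (Equiv.swap ν ν') (fun i => cosZ (k i))]
      simp
    rw [h1]
    simp
  have h2 : ∑ k : Lam d L, F (band k) * band k =
      2 * ∑ ν', ∑ k : Lam d L, F (band k) * cosZ (k ν') := by
    rw [Finset.sum_comm, Finset.mul_sum]
    refine Finset.sum_congr rfl fun k _ => ?_
    rw [band, ← Finset.mul_sum]
    ring
  rw [h2]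
  simp only [h, Finset.sum_const, Finset.card_univ, Fintype.card_fin, nsmul_eq_mul]
  ring

theorem specM_planeWaves_diag_re {d L : ℕ} [NeZero L] (f : Lam d L → ℝ) (x : Lam d L) :
    (specM (planeWaves d L) f x x).re = ((L : ℝ) ^ d)⁻¹ * ∑ k, f k := by
  have h : cosZ (0 : ZMod L) = 1 := by simp [cosZ]
  simp [specM_planeWaves_apply_re, h]

theorem specM_planeWaves_isNN_re {d L : ℕ} [NeZero L] (F : ℝ → ℝ) {x y : Lam d L}
    (h : isNN x y) :
    2 * d * (specM (planeWaves d L) (fun k => F (band k)) x y).re =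
      ((L : ℝ) ^ d)⁻¹ * ∑ k : Lam d L, F (band k) * band k := by
  obtain ⟨ν, h1, h2⟩ := h
  rw [← sum_comp_band_mul_cosZ F ν, specM_planeWaves_apply_re]
  have h3 : ∀ k : Lam d L, cosZ (∑ ν', k ν' * (x ν' - y ν')) = cosZ (k ν) := fun k => by
    rw [Finset.sum_eq_single ν]
    · rcases h1 with h1 | h1
      · rw [h1, add_sub_cancel_left, mul_one]
      · rw [← h1, sub_add_cancel_left, mul_neg_one, cosZ_neg]
    · intro ν' _ hν'
      rw [h2 ν' hν', sub_self, mul_zero]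
    · simp
  simp only [h3]
  ring

/-- Theorem 1.1, ferromagnetism: for every `d ≥ 1` and `0 < μ < 4d`
there are a finite length `L_#(μ)` and a finite coupling `U_#(μ) ≥ 0` such that for all even
`L ≥ L_#(μ)` and all `U ≥ U_#(μ)`, the HFz ground-state energy equals
`Tr{[-Δ - μ·Id]_-}`. -/
theorem hfz_ferromagnetism (d : ℕ) (hd : 1 ≤ d) (μ : ℝ) (hμ0 : 0 < μ) (hμ4 : μ < 4 * d) :
    ∃ (Lsharp : ℕ) (Usharp : ℝ), 0 ≤ Usharp ∧
      ∀ (L : ℕ) [NeZero L], Even L → Lsharp ≤ L →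
        ∀ U : ℝ, Usharp ≤ U →
          IsLeast (hfzEnergies d L μ U) (negTrace (-(lap d L) - (μ : ℂ) • 1)) := by
  have hd0 : (0 : ℝ) < d := Nat.cast_pos.2 (by omega)
  obtain ⟨q, hq, hsum⟩ := sum_band_fermi_ge (t := 2 * d - μ) hd (by linarith) (by linarith)
  set p : ℝ := q / (2 * d) with hp
  have hp0 : 0 < p := by positivity
  set η : ℝ := p ^ 2 / 512 with hη
  have hη0 : 0 < η := by positivity
  set ε : ℝ := 8 * η ^ 2 with hε
  have hε0 : 0 < ε := by positivity
  set c : ℝ := ε * p ^ 2 / 8 with hc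
  have hc0 : 0 < c := by positivity
  set K : ℝ := |2 * d - μ| + 2 * (2 * d) * (1 / 2 + 1 / (2 * c)) with hK
  have hK0 : 0 ≤ K := by positivity
  refine ⟨max 3 ⌈η⁻¹⌉₊, max (4 * K / p) (K ^ 2 / c), le_max_of_le_left (by positivity), ?_⟩
  intro L _ hLe hLs U hU
  have hL3 : 3 ≤ L := (le_max_left _ _).trans hLs
  have hL : (0 : ℝ) < L := Nat.cast_pos.2 (NeZero.pos L)
  have hLd : (0 : ℝ) < (L : ℝ) ^ d := by positivity
  have hLη : 2 / (L : ℝ) ≤ 2 * η := by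
    have h1 : η⁻¹ ≤ L := (Nat.le_ceil _).trans (Nat.cast_le.2 ((le_max_right _ _).trans hLs))
    rw [div_le_iff₀ hL]
    rw [inv_le_iff_one_le_mul₀ hη0] at h1
    linarith
  have hW := planeWaves_unitary d L
  set e : Lam d L → ℝ := fun k => 2 * d - μ - band k with he
  have hH := hamiltonian_eq_specM (d := d) hL3 μ
  have hfermi : q ≤ ((L : ℝ) ^ d)⁻¹ *
      ∑ k : Lam d L, (if 2 * d - μ - band k < 0 then (1 : ℝ) else 0) * band k := by
    rw [inv_mul_eq_div, le_div_iff₀ hLd]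
    refine (hsum L hLe).trans (le_of_eq ?_)
    refine Finset.sum_congr rfl fun k _ => ?_
    rw [ite_mul, one_mul, zero_mul]
    exact if_congr (by rw [sub_neg]) rfl rfl
  have hPo : ∀ x y : Lam d L, isNN x y →
      p ≤ (specM (planeWaves d L) (fun k => if e k < 0 then 1 else 0) y x).re := fun x y hxy => by
    have h := specM_planeWaves_isNN_re (fun b => if 2 * d - μ - b < 0 then 1 else 0)
      (isNN_comm.1 hxy)
    rw [← h] at hfermi
    rw [hp, div_le_iff₀ (by positivity), mul_comm]
    exact hfermi
  have hPd : ∀ x : Lam d L,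
      p ≤ (specM (planeWaves d L) (fun k => if e k < 0 then 1 else 0) x x).re := fun x => by
    rw [specM_planeWaves_diag_re, hp, div_le_iff₀ (by positivity)]
    refine hfermi.trans ?_
    rw [mul_assoc, Finset.sum_mul]
    gcongr with k
    exact band_le k
  have hν : ∀ x : Lam d L,
      (specM (planeWaves d L) (fun k => if |e k| < ε then 1 else 0) x x).re ≤ p ^ 2 / 64 :=
    fun x => by
      rw [specM_planeWaves_diag_re, inv_mul_eq_div, div_le_iff₀ hLd]
      refine (sum_near_level_le hd hη0.le (2 * d - μ)).trans ?_
      gcongr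
      rw [hη] at hLη ⊢
      linarith [sq_nonneg p]
  constructor
  · refine ⟨specM (planeWaves d L) (fun k => if e k < 0 then 1 else 0), 0,
      ⟨specM_posSemidef _ fun k => ?_, one_sub_specM_posSemidef hW fun k => ?_⟩,
      ⟨Matrix.PosSemidef.zero, ?_⟩, ?_⟩
    · split_ifs <;> norm_num
    · split_ifs <;> norm_num
    · rw [sub_zero]
      exact Matrix.PosSemidef.one
    · rw [hfzE, hH, negTrace_specM hW, add_zero, trace_specM_fermi hW]
      simp
  · rintro E ⟨γu, γd, ⟨u0, u1⟩, ⟨d0, d1⟩, rfl⟩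
    rw [hfzE]
    have hrow : ∀ x : Lam d L, ∑ y, (if isNN x y then (1 : ℝ) else 0) ≤ 2 * d :=
      fun x => (sum_ite_isNN hL3 x).le
    have hcol : ∀ y : Lam d L, ∑ x, (if isNN x y then (1 : ℝ) else 0) ≤ 2 * d := fun y => by
      simp only [isNN_comm (y := y)]
      exact hrow y
    refine le_pair_energy (adj := isNN) (a := 2 * d - μ) (by positivity) hrow hcol ?_ hc0 hp0 ?_
      ((le_max_left _ _).trans hU) ((le_max_right _ _).trans hU) u0 u1 d0 d1
    · rw [lap]
      push_cast
      rw [sub_smul]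
      abel
    · intro γ h0 h1
      rw [hH, negTrace_specM hW]
      exact excess_energy_count hW e hε0 hp0 hν hPd hPo h0 h1
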